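/- Let φ ∈ O(V) be orthogonally indecomposable of type 1, i.e. V = W₁ ⊕ W₂ with W₁, W₂ nonzero φ-invariant subspaces on which φ is cyclic with equal minimal polynomials (x−ε)^m for some ε ∈ {1,−1}. Let σ ∈ O(V) be an involution reversing φ (σ² = 1, σφσ⁻¹ = φ⁻¹). Then: (1) Bahn(σ) and Fix(σ) are hyperbolic; (2) dim Bahn(σ) = dim Fix(σ) = (dim V)/2; (3) φ ∈ Ω(V); (4) det σ = 1 and Θ(σ) is the square class of (−1)^{(dim V)/4}. -/

import Mathlib

open Polynomial

noncomputable section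

namespace GenBireflect

variable {K : Type*} [Field K] {M : Type*} [AddCommGroup M] [Module K M]
variable (B : LinearMap.BilinForm K M)

/-- The orthogonal group of the bilinear space `(M, B)`. -/
def OG : Subgroup (M ≃ₗ[K] M) where
  carrier := {φ | ∀ x y, B (φ x) (φ y) = B x y}
  one_mem' := fun _ _ => rfl
  mul_mem' := by
    intro a b ha hb x y
    exact (ha (b x) (b y)).trans (hb x y)
  inv_mem' := by
    intro φ h x y
    have := h (φ⁻¹ x) (φ⁻¹ y)
    have e : ∀ z, φ (φ⁻¹ z) = z := fun z => φ.apply_symm_apply z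
    rw [e, e] at this
    exact this.symm

/-- The commutator subgroup `Ω(M, B)` of the orthogonal group. -/
def ΩG : Subgroup (M ≃ₗ[K] M) := ⁅OG B, OG B⁆

def IsNondegOn (U : Submodule K M) : Prop :=
  ∀ x ∈ U, (∀ y ∈ U, B x y = 0) → x = 0

def orthComp (U : Submodule K M) : Submodule K M where
  carrier := {x | ∀ y ∈ U, B x y = 0}
  add_mem' := by
    intro a b ha hb y hy
    simp [map_add, LinearMap.add_apply, ha y hy, hb y hy]
  zero_mem' := by intro y hy; simp
  smul_mem' := by
    intro c a ha y hy
    simp [map_smul, LinearMap.smul_apply, ha y hy]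

def InvariantUnder (φ : M ≃ₗ[K] M) (U : Submodule K M) : Prop :=
  ∀ x ∈ U, φ x ∈ U

def IsOrthSummand (φ : M ≃ₗ[K] M) (U : Submodule K M) : Prop :=
  InvariantUnder φ U ∧ IsNondegOn B U ∧ InvariantUnder φ (orthComp B U)

def IsOrthSummandIn (φ : M ≃ₗ[K] M) (U W : Submodule K M) : Prop :=
  W ≤ U ∧ InvariantUnder φ W ∧ IsNondegOn B W ∧ InvariantUnder φ (U ⊓ orthComp B W)

def IndecomposableOn (φ : M ≃ₗ[K] M) (U : Submodule K M) : Prop :=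
  U ≠ ⊥ ∧ ∀ W, IsOrthSummandIn B φ U W → W = ⊥ ∨ W = U

def Indecomposable (φ : M ≃ₗ[K] M) : Prop := IndecomposableOn B φ ⊤

def CyclicOn (φ : M ≃ₗ[K] M) (U : Submodule K M) : Prop :=
  ∃ u : M, U = Submodule.span K (Set.range fun i : ℕ => ((φ : M →ₗ[K] M) ^ i) u)

def MinpolyOn (φ : M ≃ₗ[K] M) (U : Submodule K M) (f : K[X]) : Prop :=
  ∃ h : ∀ x ∈ U, (φ : M →ₗ[K] M) x ∈ U,
    minpoly K (((φ : M →ₗ[K] M).restrict h : U →ₗ[K] U)) = f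

def TotallyIsotropic (T : Submodule K M) : Prop :=
  ∀ x ∈ T, ∀ y ∈ T, B x y = 0

def IsHyperbolic (U : Submodule K M) : Prop :=
  ∃ T : Submodule K M, T ≤ U ∧ TotallyIsotropic B T ∧
    2 * Module.finrank K T = Module.finrank K U

def Bahn (φ : M ≃ₗ[K] M) : Submodule K M :=
  LinearMap.range ((φ : M →ₗ[K] M) - LinearMap.id)

def Fix (φ : M ≃ₗ[K] M) : Submodule K M :=
  LinearMap.ker ((φ : M →ₗ[K] M) - LinearMap.id)

/-- The reflection along an anisotropic vector `v`: `x ↦ x - (2 B x v / B v v) • v`. -/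
def reflMap (v : M) : M →ₗ[K] M :=
  LinearMap.id - (B.flip v).smulRight ((2 / B v v) • v)

/-- `l` is a list of anisotropic vectors expressing `φ` as the product of the
corresponding reflections. -/
def IsReflExpr (φ : M ≃ₗ[K] M) (l : List M) : Prop :=
  (∀ v ∈ l, B v v ≠ 0) ∧ (φ : M →ₗ[K] M) = (l.map (reflMap B)).prod

/-- The product `B v₁ v₁ ⋯ B v_k v_k` attached to a list of vectors. -/
def sprod (l : List M) : K := (l.map fun v => B v v).prod

/-- `φ` is of type 1: `M = W₁ ⊕ W₂` with `W₁, W₂` nonzero `φ`-invariant subspaces on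
which `φ` is cyclic with equal minimal polynomials `(X - ε)^m`, `ε = ±1`. -/
def IsType1 (φ : M ≃ₗ[K] M) : Prop :=
  ∃ (W₁ W₂ : Submodule K M) (ε : K) (m : ℕ),
    W₁ ≠ ⊥ ∧ W₂ ≠ ⊥ ∧ W₁ ⊓ W₂ = ⊥ ∧ W₁ ⊔ W₂ = ⊤ ∧
    InvariantUnder φ W₁ ∧ InvariantUnder φ W₂ ∧
    CyclicOn φ W₁ ∧ CyclicOn φ W₂ ∧ (ε = 1 ∨ ε = -1) ∧
    MinpolyOn φ W₁ ((X - C ε) ^ m) ∧ MinpolyOn φ W₂ ((X - C ε) ^ m)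

/-- `φ` is of type 2±: cyclic on `M` with minimal polynomial `(X - ε)^(dim M)`, `ε = ±1`. -/
def IsType2pm (φ : M ≃ₗ[K] M) : Prop :=
  CyclicOn φ ⊤ ∧ ∃ ε : K, (ε = 1 ∨ ε = -1) ∧
    minpoly K (φ : M →ₗ[K] M) = (X - C ε) ^ (Module.finrank K M)

theorem Matrix.isSquare_det_of_alternating {K : Type*} [Field K] :
    ∀ (n : ℕ) (A : Matrix (Fin n) (Fin n) K),
    (∀ i, A i i = 0) → (∀ i j, A i j = -A j i) → IsSquare A.det := by
  intro n
  induction n using Nat.strong_induction_on with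
  | _ n ih =>
  intro A hd hs
  match n, ih, A, hd, hs with
  | 0, _, A, _, _ => exact ⟨1, by simp⟩
  | n + 1, ih, A, hd, hs =>
    by_cases h0 : ∀ j, A 0 j = 0
    · rw [Matrix.det_eq_zero_of_row_eq_zero 0 h0]
      exact ⟨0, by simp⟩
    push Not at h0
    obtain ⟨j, hj⟩ := h0
    match n, ih, A, hd, hs, j, hj with
    | 0, _, A, hd, _, j, hj =>
      obtain rfl : j = 0 := by ext; omega
      exact absurd (hd 0) hj
    | n + 1, ih, A, hd, hs, j, hj =>
      have hj0 : j ≠ 0 := by rintro rfl; exact hj (hd 0)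
      let e : Fin 2 ⊕ Fin n ≃ Fin (n + 2) :=
        (finSumFinEquiv.trans (finCongr (by omega))).trans (Equiv.swap 1 j)
      have he0 : e (Sum.inl 0) = 0 := by
        simp only [e, Equiv.trans_apply, finSumFinEquiv_apply_left]
        have : (finCongr (by omega : 2 + n = n + 2)) (Fin.castAdd n (0 : Fin 2)) = 0 := by
          ext; simp
        rw [this]
        exact Equiv.swap_apply_of_ne_of_ne (by simp) hj0.symm
      have he1 : e (Sum.inl 1) = j := by
        simp only [e, Equiv.trans_apply, finSumFinEquiv_apply_left]
        have : (finCongr (by omega : 2 + n = n + 2)) (Fin.castAdd n (1 : Fin 2)) = 1 := by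
          ext; simp
        rw [this]
        exact Equiv.swap_apply_left _ _
      set C := A.submatrix e e with hC
      have hCd : ∀ i, C i i = 0 := fun i => hd _
      have hCs : ∀ i k, C i k = -C k i := fun i k => hs _ _
      have hdet : A.det = C.det := (Matrix.det_submatrix_equiv_self e A).symm
      set a := A 0 j with ha
      have hP : C.toBlocks₁₁ = !![0, a; -a, 0] := by
        ext i k
        fin_cases i <;> fin_cases k <;>
          simp [Matrix.toBlocks₁₁, hC, he0, he1, hd, ha, hs j 0]
      have hPdet : C.toBlocks₁₁.det = a ^ 2 := by
        rw [hP, Matrix.det_fin_two_of]; ring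
      let Q : Matrix (Fin 2) (Fin 2) K := !![0, -a⁻¹; a⁻¹, 0]
      have hQ : C.toBlocks₁₁ * Q = 1 := by
        rw [hP]
        ext i k
        fin_cases i <;> fin_cases k <;> simp [Q, Matrix.mul_apply, hj]
      have hQ' : Q * C.toBlocks₁₁ = 1 := by
        rw [hP]
        ext i k
        fin_cases i <;> fin_cases k <;> simp [Q, Matrix.mul_apply, hj]
      let _ : Invertible C.toBlocks₁₁ := ⟨Q, hQ', hQ⟩
      have hinvQ : ⅟ C.toBlocks₁₁ = Q := rfl
      rw [hdet, ← Matrix.fromBlocks_toBlocks C, Matrix.det_fromBlocks₁₁, hPdet, hinvQ]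
      have hE : ∀ i k, (C.toBlocks₂₁ * Q * C.toBlocks₁₂) i k
          = a⁻¹ * (C (.inr i) (.inl 1) * C (.inl 0) (.inr k)
            - C (.inr i) (.inl 0) * C (.inl 1) (.inr k)) := by
        intro i k
        simp [Q, Matrix.mul_apply, Matrix.toBlocks₂₁, Matrix.toBlocks₁₂]
        ring
      have := ih n (by omega) (C.toBlocks₂₂ - C.toBlocks₂₁ * Q * C.toBlocks₁₂) ?_ ?_
      · exact IsSquare.mul ⟨a, sq a⟩ this
      · intro i
        rw [Matrix.sub_apply, hE]
        simp only [Matrix.toBlocks₂₂, Matrix.of_apply, hCd]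
        rw [hCs (.inr i) (.inl 1), hCs (.inr i) (.inl 0)]
        ring
      · intro i k
        rw [Matrix.sub_apply, Matrix.sub_apply, hE, hE]
        simp only [Matrix.toBlocks₂₂, Matrix.of_apply]
        rw [hCs (.inr i) (.inr k), hCs (.inr i) (.inl 1), hCs (.inr i) (.inl 0),
          hCs (.inr k) (.inl 1), hCs (.inr k) (.inl 0)]
        ring

/-- A linear map `f` together with vectors `w` and an invertible matrix `A` whose symmetrisation is
the Gram matrix of `w`, such that `f x = x - ∑ cᵢ wᵢ` where `A c = (B (wᵢ) x)ᵢ`. -/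
structure IsWallData {ι : Type*} [Fintype ι] [DecidableEq ι] (w : ι → M) (A : Matrix ι ι K)
    (f : M →ₗ[K] M) : Prop where
  det_ne_zero : A.det ≠ 0
  gram : ∀ i j, B (w i) (w j) = A i j + A j i
  apply : ∀ x, ∃ c : ι → K, (∀ i, ∑ j, A i j * c j = B (w i) x) ∧ f x = x - ∑ i, c i • w i

variable {B}

theorem IsWallData.mul {ι κ : Type*} [Fintype ι] [DecidableEq ι] [Fintype κ] [DecidableEq κ]
    (hsymm : ∀ x y, B x y = B y x)
    {w : ι → M} {A : Matrix ι ι K} {f : M →ₗ[K] M} {w' : κ → M} {A' : Matrix κ κ K}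
    {f' : M →ₗ[K] M} (h : IsWallData B w A f) (h' : IsWallData B w' A' f') :
    IsWallData B (Sum.elim w w')
      (Matrix.fromBlocks A (Matrix.of fun i j => B (w i) (w' j)) 0 A') (f * f') where
  det_ne_zero := by
    rw [Matrix.det_fromBlocks_zero₂₁]
    exact mul_ne_zero h.det_ne_zero h'.det_ne_zero
  gram := by
    rintro (i | i) (j | j)
    · simpa using h.gram i j
    · simp
    · simp [hsymm (w' i)]
    · simpa using h'.gram i j
  apply x := by
    obtain ⟨c', hc', hf'⟩ := h'.apply x
    obtain ⟨c, hc, hf⟩ := h.apply (f' x)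
    refine ⟨Sum.elim c c', ?_, ?_⟩
    · rintro (i | i)
      · simp only [Fintype.sum_sum_type, Matrix.fromBlocks_apply₁₁, Matrix.fromBlocks_apply₁₂,
          Sum.elim_inl, Sum.elim_inr, hc, hf', map_sub, map_sum, map_smul, Matrix.of_apply,
          smul_eq_mul, mul_comm (c' _)]
        ring
      · simpa using hc' i
    · rw [Module.End.mul_apply, hf, hf', Fintype.sum_sum_type]
      simp only [Sum.elim_inl, Sum.elim_inr]
      abel

theorem IsWallData.reindex {ι κ : Type*} [Fintype ι] [DecidableEq ι] [Fintype κ] [DecidableEq κ]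
    {w : ι → M} {A : Matrix ι ι K} {f : M →ₗ[K] M} (h : IsWallData B w A f) (e : κ ≃ ι) :
    IsWallData B (w ∘ e) (A.submatrix e e) f where
  det_ne_zero := by
    rw [Matrix.det_submatrix_equiv_self]
    exact h.det_ne_zero
  gram i j := h.gram (e i) (e j)
  apply x := by
    obtain ⟨c, hc, hf⟩ := h.apply x
    refine ⟨c ∘ e, fun i => ?_, ?_⟩
    · rw [Function.comp_apply, ← hc (e i)]
      exact Equiv.sum_comp e fun j => A (e i) j * c j
    · rw [hf]
      congr 1
      exact (Equiv.sum_comp e fun j => c j • w j).symm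

theorem isWallData_reflMap (h2 : (2 : K) ≠ 0) (hsymm : ∀ x y, B x y = B y x) {v : M}
    (hv : B v v ≠ 0) :
    IsWallData B (fun _ : Unit => v) (Matrix.of fun _ _ => B v v / 2) (reflMap B v) where
  det_ne_zero := by simp [hv, h2]
  gram _ _ := by simp [← two_mul, mul_div_cancel₀, h2]
  apply x := by
    refine ⟨fun _ => 2 * B v x / B v v, fun _ => ?_, ?_⟩
    · simp
      field_simp
    · simp [reflMap, smul_smul, hsymm x v]
      congr 1
      ring

theorem exists_isWallData_prod_reflMap (h2 : (2 : K) ≠ 0) (hsymm : ∀ x y, B x y = B y x)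
    (l : List M) (hl : ∀ v ∈ l, B v v ≠ 0) :
    ∃ (n : ℕ) (w : Fin n → M) (A : Matrix (Fin n) (Fin n) K),
      IsWallData B w A (l.map (reflMap B)).prod ∧ n = l.length ∧ A.det * 2 ^ n = sprod B l := by
  induction l with
  | nil =>
    exact ⟨0, Fin.elim0, 0, ⟨by simp, fun i => i.elim0, fun x => ⟨0, fun i => i.elim0, by simp⟩⟩,
      rfl, by simp [sprod]⟩
  | cons v l ih =>
    obtain ⟨n, w, A, h, hn, hA⟩ := ih fun u hu => hl u (List.mem_cons_of_mem _ hu)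
    have hv := hl v List.mem_cons_self
    have key := (isWallData_reflMap h2 hsymm hv).mul hsymm h
    let e : Fin (n + 1) ≃ Unit ⊕ Fin n := Fintype.equivOfCardEq (by simp [add_comm])
    refine ⟨n + 1, _, _, key.reindex e, by simp [hn], ?_⟩
    rw [Matrix.det_submatrix_equiv_self, Matrix.det_fromBlocks_zero₂₁, Matrix.det_unique,
      Matrix.of_apply, sprod, List.map_cons, List.prod_cons, ← sprod, ← hA]
    field_simp
    ring

/-- If the identity is expressed by `(w, A)`, then `(A - Aᵀ) / 2` and `A` have the same determinant
up to a nonzero square. -/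
theorem IsWallData.exists_det_skew_eq (h2 : (2 : K) ≠ 0) {ι : Type*} [Fintype ι] [DecidableEq ι]
    {w : ι → M} {A : Matrix ι ι K} (h : IsWallData B w A 1) :
    ∃ d : K, d ≠ 0 ∧ ((2⁻¹ : K) • (A - A.transpose)).det = A.det * d ^ 2 := by
  set G := A + A.transpose with hG
  have hAu : IsUnit A.det := isUnit_iff_ne_zero.mpr h.det_ne_zero
  have hGA : G * (A⁻¹ * G) = 0 := by
    ext i j
    obtain ⟨c, hc, hf⟩ := h.apply (w j)
    have hc' : A.mulVec c = fun i => G i j := by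
      ext i
      rw [Matrix.mulVec, dotProduct, hc, h.gram, hG, Matrix.add_apply, Matrix.transpose_apply]
    have hcA : c = A⁻¹.mulVec fun i => G i j := by
      rw [← hc', Matrix.mulVec_mulVec, Matrix.nonsing_inv_mul _ hAu, Matrix.one_mulVec]
    have h0 : ∑ i, c i • w i = 0 := sub_eq_self.mp hf.symm
    have hk : ∀ k, (A⁻¹ * G) k j = c k := fun k => by rw [hcA]; rfl
    rw [Matrix.mul_apply, Matrix.zero_apply]
    have := congrArg (B (w i)) h0
    simp only [map_sum, map_smul, smul_eq_mul, map_zero] at this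
    rw [← this]
    refine Finset.sum_congr rfl fun k _ => ?_
    rw [hk, h.gram, hG, Matrix.add_apply, Matrix.transpose_apply, mul_comm]
  set X := A⁻¹ * G with hX
  have hXX : X * X = 0 := by
    rw [hX, Matrix.mul_assoc, hGA, Matrix.mul_zero]
  have hAX : A * X = G := by
    rw [hX, ← Matrix.mul_assoc, Matrix.mul_nonsing_inv _ hAu, Matrix.one_mul]
  have h4 : (4 : K) ≠ 0 := by
    have : (4 : K) = 2 * 2 := by norm_num
    rw [this]; exact mul_ne_zero h2 h2
  refine ⟨(1 - (4⁻¹ : K) • X).det, fun h0 => ?_, ?_⟩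
  · have : (1 - (4⁻¹ : K) • X) * (1 + (4⁻¹ : K) • X) = 1 := by
      simp [sub_mul, mul_add, hXX]
    have := congrArg Matrix.det this
    rw [Matrix.det_mul, h0] at this
    simp at this
  · rw [sq, ← Matrix.det_mul, ← Matrix.det_mul]
    congr 1
    have h1 : (1 - (4⁻¹ : K) • X) * (1 - (4⁻¹ : K) • X) = 1 - (2⁻¹ : K) • X := by
      have : (2⁻¹ : K) = 4⁻¹ + 4⁻¹ := by field_simp; norm_num
      simp only [sub_mul, mul_sub, one_mul, mul_one, smul_mul_smul_comm, hXX, this, add_smul]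
      simp
      abel
    rw [h1, mul_sub, mul_one, mul_smul_comm, hAX, hG]
    ext i j
    simp
    field_simp
    ring

theorem IsWallData.isSquare_det (h2 : (2 : K) ≠ 0) {ι : Type*} [Fintype ι] [DecidableEq ι]
    {w : ι → M} {A : Matrix ι ι K} (h : IsWallData B w A 1) : IsSquare A.det := by
  have e := (Fintype.equivFin ι).symm
  have h' := h.reindex e
  rw [← Matrix.det_submatrix_equiv_self e]
  obtain ⟨d, hd, hdet⟩ := h'.exists_det_skew_eq h2
  obtain ⟨r, hr⟩ := Matrix.isSquare_det_of_alternating _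
    ((2⁻¹ : K) • (A.submatrix e e - (A.submatrix e e).transpose)) (by simp)
    (fun i j => by simp; ring)
  refine ⟨r / d, ?_⟩
  rw [hr] at hdet
  field_simp
  linear_combination -hdet

theorem IsWallData.even_card (h2 : (2 : K) ≠ 0) {ι : Type*} [Fintype ι] [DecidableEq ι]
    {w : ι → M} {A : Matrix ι ι K} (h : IsWallData B w A 1) : Even (Fintype.card ι) := by
  obtain ⟨d, hd, hdet⟩ := h.exists_det_skew_eq h2
  by_contra hodd
  rw [Nat.not_even_iff_odd] at hodd
  have h0 : ((2⁻¹ : K) • (A - A.transpose)).det ≠ 0 := by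
    rw [hdet]
    exact mul_ne_zero h.det_ne_zero (pow_ne_zero _ hd)
  have ht : ((2⁻¹ : K) • (A - A.transpose)).transpose = -((2⁻¹ : K) • (A - A.transpose)) := by
    ext i j
    simp
    ring
  have := Matrix.det_transpose ((2⁻¹ : K) • (A - A.transpose))
  rw [ht, Matrix.det_neg, hodd.neg_one_pow] at this
  have h20 : 2 * ((2⁻¹ : K) • (A - A.transpose)).det = 0 := by linear_combination -this
  exact (mul_ne_zero h2 h0) h20

/-- Two families `t`, `y` with `t` spanning a totally isotropic subspace and with invertible
pairing matrix give rise to a hyperbolic family in any subspace containing both. -/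
theorem exists_hyperbolic_family_of_pairing (h2 : (2 : K) ≠ 0) (hsymm : ∀ x y, B x y = B y x)
    {n : ℕ} (U : Submodule K M) {t y : Fin n → M} (ht : ∀ i, t i ∈ U) (hy : ∀ i, y i ∈ U)
    (htt : ∀ i j, B (t i) (t j) = 0)
    (hP : (Matrix.of fun i j => B (t i) (y j)).det ≠ 0) :
    ∃ w : Fin n ⊕ Fin n → M, (∀ i, w i ∈ U) ∧
      ∀ i j, B (w i) (w j) = Matrix.fromBlocks (0 : Matrix (Fin n) (Fin n) K) 1 1 0 i j := by
  set P : Matrix (Fin n) (Fin n) K := Matrix.of fun i j => B (t i) (y j) with hPdef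
  have hPu : IsUnit P.det := isUnit_iff_ne_zero.mpr hP
  let s : Fin n → M := fun j => ∑ l, P⁻¹ l j • y l
  have hsU : ∀ j, s j ∈ U := fun j => U.sum_mem fun l _ => U.smul_mem _ (hy l)
  have hts : ∀ i j, B (t i) (s j) = (1 : Matrix (Fin n) (Fin n) K) i j := fun i j => by
    rw [← Matrix.mul_nonsing_inv _ hPu, Matrix.mul_apply]
    simp [s, hPdef, mul_comm]
  let r : Fin n → M := fun j => s j - (2⁻¹ : K) • ∑ l, B (s j) (s l) • t l
  have htr : ∀ i j, B (t i) (r j) = (1 : Matrix (Fin n) (Fin n) K) i j := fun i j => by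
    simp [r, hts, htt]
  have hrr : ∀ i j, B (r i) (r j) = 0 := fun i j => by
    have hsr : B (s i) (r j) = 2⁻¹ * B (s i) (s j) := by
      simp only [r, map_sub, map_smul, map_sum, smul_eq_mul, hsymm (s i) (t _), hts,
        Matrix.one_apply, mul_ite, mul_one, mul_zero, Finset.sum_ite_eq',
        Finset.mem_univ, if_true]
      rw [hsymm (s j) (s i)]
      field_simp
      ring
    have : B (r i) (r j) = B (s i) (r j) - 2⁻¹ * ∑ l, B (s i) (s l) * B (t l) (r j) := by
      conv_lhs => rw [show r i = s i - (2⁻¹ : K) • ∑ l, B (s i) (s l) • t l from rfl]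
      simp
    rw [this, hsr]
    simp [htr, Matrix.one_apply]
  refine ⟨Sum.elim t r, ?_, ?_⟩
  · rintro (i | i)
    · exact ht i
    · exact U.sub_mem (hsU i) (U.smul_mem _ (U.sum_mem fun l _ => U.smul_mem _ (ht l)))
  · rintro (i | i) (j | j)
    · simp [htt]
    · simp [htr]
    · simp [hsymm (r i) (t j), htr, Matrix.one_apply, eq_comm]
    · simp [hrr]

/-- The adjunction rule for powers of a skew-adjoint map. -/
theorem skew_pow_apply {A : M →ₗ[K] M} (hA : ∀ x y, B (A x) y = -B x (A y)) (n : ℕ) (x y : M) :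
    B ((A ^ n) x) y = (-1) ^ n * B x ((A ^ n) y) := by
  induction n generalizing x y with
  | zero => simp
  | succ n ih =>
    rw [pow_succ, Module.End.mul_apply, ih, hA, ← Module.End.mul_apply, ← pow_succ',
      ← pow_succ]
    ring

theorem anticomm_pow_apply {A S : M →ₗ[K] M} (hSA : ∀ x, S (A x) = -A (S x)) (n : ℕ) (x : M) :
    S ((A ^ n) x) = (-1 : K) ^ n • (A ^ n) (S x) := by
  induction n generalizing x with
  | zero => simp
  | succ n ih =>
    rw [pow_succ, Module.End.mul_apply, ih, hSA, map_neg, Module.End.mul_apply, pow_succ]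
    simp

/-- An isometric involution `S` anticommuting with a skew-adjoint nilpotent `A` of even index
`2 k + 2` has a hyperbolic family of `2 (k + 1)` vectors in its fixed space. -/
theorem exists_hyperbolic_family (h2 : (2 : K) ≠ 0) (hsymm : ∀ x y, B x y = B y x)
    (hnd : ∀ x, (∀ y, B x y = 0) → x = 0) {A S : M →ₗ[K] M} {k : ℕ}
    (hA : ∀ x y, B (A x) y = -B x (A y)) (hSS : ∀ x, S (S x) = x)
    (hSB : ∀ x y, B (S x) (S y) = B x y) (hSA : ∀ x, S (A x) = -A (S x))
    (h0 : A ^ (2 * k + 2) = 0) (h1 : A ^ (2 * k + 1) ≠ 0) :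
    ∃ w : Fin (k + 1) ⊕ Fin (k + 1) → M, (∀ i, S (w i) = w i) ∧
      ∀ i j, B (w i) (w j)
        = Matrix.fromBlocks (0 : Matrix (Fin (k + 1)) (Fin (k + 1)) K) 1 1 0 i j := by
  have hodd : (-1 : K) ^ (2 * k + 1) = -1 := (odd_two_mul_add_one k).neg_one_pow
  have hzero : ∀ n, 2 * k + 2 ≤ n → A ^ n = 0 := fun n hn => by
    rw [← Nat.sub_add_cancel hn, pow_add, h0, mul_zero]
  have hHsw : ∀ x y, B x ((A ^ (2 * k + 1)) y) = -B y ((A ^ (2 * k + 1)) x) := fun x y => by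
    rw [hsymm, skew_pow_apply hA, hodd, neg_one_mul]
  have hHS : ∀ x y, B (S x) ((A ^ (2 * k + 1)) (S y)) = -B x ((A ^ (2 * k + 1)) y) := fun x y => by
    have := anticomm_pow_apply hSA (2 * k + 1) y
    rw [hodd, neg_one_smul] at this
    rw [← hSB x, this, map_neg, neg_neg]
  obtain ⟨p, q, hp, hq, hpq⟩ : ∃ p q, S p = p ∧ S q = -q ∧ B p ((A ^ (2 * k + 1)) q) ≠ 0 := by
    by_contra! hcon
    apply h1
    ext y
    refine hnd _ fun x => ?_
    rw [hsymm]
    have a1 : ∀ x y, B x ((A ^ (2 * k + 1)) y) = -B (S x) ((A ^ (2 * k + 1)) y) := fun x y => by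
      have e1 := hcon (x + S x) (y - S y) (by rw [map_add, hSS, add_comm])
        (by rw [map_sub, hSS, neg_sub])
      have e2 := hHS x y
      have e3 := hHS x (S y)
      rw [hSS] at e3
      simp only [map_add, map_sub, LinearMap.add_apply] at e1
      apply mul_left_cancel₀ h2
      linear_combination e1 + e2 + e3
    have a2 := a1 x y
    have a3 : B x ((A ^ (2 * k + 1)) (S y)) = -B x ((A ^ (2 * k + 1)) y) := by
      rw [hHsw x (S y), hHsw x y, a1 y x]
      ring
    have a4 := hHS x (S y)
    rw [hSS] at a4
    have a5 : 2 * B x ((A ^ (2 * k + 1)) y) = 0 := by linear_combination a2 - a4 + a3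
    exact (mul_eq_zero.mp a5).resolve_left h2
  let e : ℕ → M := fun i => if Even i then p else q
  let b : ℕ → M := fun i => (A ^ i) (e i)
  have hSe : ∀ i, S (e i) = (-1 : K) ^ i • e i := fun i => by
    by_cases hi : Even i
    · simp [e, hi, hp, hi.neg_one_pow]
    · simp [e, hi, hq, (Nat.not_even_iff_odd.mp hi).neg_one_pow]
  have hSb : ∀ i, S (b i) = b i := fun i => by
    simp only [b, anticomm_pow_apply hSA, hSe, map_smul, smul_smul, ← mul_pow]
    simp
  have hbb : ∀ i j, B (b i) (b j) = (-1) ^ i * B (e i) ((A ^ (i + j)) (e j)) := fun i j => by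
    simp only [b, skew_pow_apply hA, pow_add, Module.End.mul_apply]
  have hb0 : ∀ i j, 2 * k + 2 ≤ i + j → B (b i) (b j) = 0 := fun i j hij => by
    rw [hbb, hzero _ hij]; simp
  have hb1 : ∀ i j, i + j = 2 * k + 1 → B (b i) (b j) ≠ 0 := fun i j hij => by
    rw [hbb, hij]
    refine mul_ne_zero (pow_ne_zero _ (by simp)) ?_
    by_cases hi : Even i
    · have hj : ¬Even j := by
        rw [Nat.even_iff] at hi ⊢; omega
      simpa [e, hi, hj] using hpq
    · have hj : Even j := by
        rw [Nat.even_iff] at hi ⊢; omega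
      simp only [e, hi, hj, if_true, if_false]
      rw [hHsw]
      exact neg_ne_zero.mpr hpq
  obtain ⟨w, hw, hG⟩ := exists_hyperbolic_family_of_pairing h2 hsymm (n := k + 1)
    (LinearMap.eqLocus S LinearMap.id) (t := fun i => b (k + 1 + i)) (y := fun j => b (k - j))
    (fun i => hSb _) (fun i => hSb _) (fun i j => hb0 _ _ (by omega)) (by
      rw [Matrix.det_of_isUpperTriangular]
      · refine Finset.prod_ne_zero_iff.mpr fun i _ => hb1 _ _ ?_
        have := i.2
        omega
      · intro i j hij
        have : (j : ℕ) < i := hij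
        exact hb0 _ _ (by omega))
  exact ⟨w, hw, hG⟩

/-- The Gram matrix of an orthogonal sum of two hyperbolic spaces of dimension `2 n`. -/
abbrev hyperbolicSumGram (K : Type*) [Field K] (n : ℕ) :
    Matrix ((Fin n ⊕ Fin n) ⊕ (Fin n ⊕ Fin n)) ((Fin n ⊕ Fin n) ⊕ (Fin n ⊕ Fin n)) K :=
  Matrix.fromBlocks (Matrix.fromBlocks 0 1 1 0) 0 0 (Matrix.fromBlocks 0 1 1 0)

theorem linearIndependent_of_gram {ι : Type*} [Fintype ι] [DecidableEq ι] {w : ι → M}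
    {G : Matrix ι ι K} (hG : ∀ i j, B (w i) (w j) = G i j) (hdet : G.det ≠ 0) :
    LinearIndependent K w := by
  rw [Fintype.linearIndependent_iff]
  intro c hc
  have : G.mulVec c = 0 := by
    ext i
    have := congrArg (B (w i)) hc
    simp only [map_sum, map_smul, smul_eq_mul, map_zero, hG] at this
    simpa [Matrix.mulVec, dotProduct, mul_comm] using this
  exact fun i => congrFun (Matrix.eq_zero_of_mulVec_eq_zero hdet this) i

theorem det_hyperbolic (n : ℕ) :
    (Matrix.fromBlocks (0 : Matrix (Fin n) (Fin n) K) 1 1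
      (0 : Matrix (Fin n) (Fin n) K)).det = (-1) ^ n := by
  have h : Matrix.fromBlocks (0 : Matrix (Fin n) (Fin n) K) 1 1 0
      * Matrix.fromBlocks (1 : Matrix (Fin n) (Fin n) K) 0 1 (1 : Matrix (Fin n) (Fin n) K)
      = Matrix.fromBlocks 1 1 1 0 := by
    simp [Matrix.fromBlocks_multiply]
  have := congrArg Matrix.det h
  rw [Matrix.det_mul, Matrix.det_fromBlocks_zero₁₂, Matrix.det_fromBlocks_one₁₁] at this
  simpa [Matrix.det_neg] using this

/-- A basis of hyperbolic pairs adapted to the eigenspace decomposition of an involution. -/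
theorem exists_adapted_basis [FiniteDimensional K M] (h2 : (2 : K) ≠ 0)
    (hsymm : ∀ x y, B x y = B y x) (hnd : ∀ x, (∀ y, B x y = 0) → x = 0)
    {A S : M →ₗ[K] M} {k : ℕ} (hdim : Module.finrank K M ≤ 4 * (k + 1))
    (hA : ∀ x y, B (A x) y = -B x (A y)) (hSS : ∀ x, S (S x) = x)
    (hSB : ∀ x y, B (S x) (S y) = B x y) (hSA : ∀ x, S (A x) = -A (S x))
    (h0 : A ^ (2 * k + 2) = 0) (h1 : A ^ (2 * k + 1) ≠ 0) :
    ∃ b : Module.Basis ((Fin (k + 1) ⊕ Fin (k + 1)) ⊕ (Fin (k + 1) ⊕ Fin (k + 1))) K M,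
      (∀ i, S (b (.inl i)) = b (.inl i)) ∧ (∀ i, S (b (.inr i)) = -b (.inr i)) ∧
      ∀ i j, B (b i) (b j) = hyperbolicSumGram K (k + 1) i j := by
  obtain ⟨u, hu, hGu⟩ := exists_hyperbolic_family h2 hsymm hnd hA hSS hSB hSA h0 h1
  obtain ⟨v, hv, hGv⟩ := exists_hyperbolic_family (S := -S) h2 hsymm hnd hA (by simp [hSS])
    (by simp [hSB]) (by simp [hSA]) h0 h1
  have hv' : ∀ i, S (v i) = -v i := fun i => by
    have := hv i
    rw [LinearMap.neg_apply] at this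
    rw [← this, neg_neg, this]
  have huv : ∀ i j, B (u i) (v j) = 0 := fun i j => by
    have := hSB (u i) (v j)
    rw [hu, hv', map_neg] at this
    have h : 2 * B (u i) (v j) = 0 := by linear_combination -this
    exact (mul_eq_zero.mp h).resolve_left h2
  have hG : ∀ i j, B (Sum.elim u v i) (Sum.elim u v j) = hyperbolicSumGram K (k + 1) i j := by
    rintro (i | i) (j | j)
    · exact hGu i j
    · exact huv i j
    · exact (hsymm _ _).trans (huv j i)
    · exact hGv i j
  have hli := linearIndependent_of_gram hG (by
    rw [Matrix.det_fromBlocks_zero₂₁, det_hyperbolic]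
    simp)
  have hcard : Fintype.card ((Fin (k + 1) ⊕ Fin (k + 1)) ⊕ (Fin (k + 1) ⊕ Fin (k + 1)))
      = Module.finrank K M :=
    le_antisymm hli.fintype_card_le_finrank (hdim.trans (by simp; omega))
  refine ⟨basisOfLinearIndependentOfCardEqFinrank hli hcard, ?_, ?_, ?_⟩
  · simpa using hu
  · simpa using hv'
  · simpa using hG

theorem finrank_le_of_le_span_sup_map [FiniteDimensional K M] {A : M →ₗ[K] M} {U : Submodule K M}
    {x : M} (hU : U ≤ Submodule.span K {x} ⊔ U.map A) {m : ℕ} (h0 : A ^ m = 0) :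
    Module.finrank K U ≤ m := by
  have step : ∀ k, Module.finrank K (U.map (A ^ k)) ≤ 1 + Module.finrank K (U.map (A ^ (k + 1))) :=
    fun k => by
      have h1 : U.map (A ^ k) ≤ Submodule.span K {(A ^ k) x} ⊔ U.map (A ^ (k + 1)) := by
        refine (Submodule.map_mono hU).trans ?_
        rw [Submodule.map_sup, Submodule.map_span, Set.image_singleton, pow_succ,
          Module.End.mul_eq_comp, Submodule.map_comp]
      refine (Submodule.finrank_mono h1).trans
        ((Submodule.finrank_add_le_finrank_add_finrank _ _).trans ?_)
      gcongr
      exact (finrank_span_le_card _).trans (by simp)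
  have key : ∀ k, Module.finrank K U ≤ k + Module.finrank K (U.map (A ^ k)) := fun k => by
    induction k with
    | zero => rw [pow_zero, Module.End.one_eq_id, Submodule.map_id, zero_add]
    | succ k ih => have := step k; omega
  have := key m
  rwa [h0, Submodule.map_zero, finrank_bot, add_zero] at this

section Unipotent

variable {f g : M →ₗ[K] M} {ε : K} {m : ℕ}

theorem sub_inverse_eq_mul (hfg : f * g = 1) (hε : ε * ε = 1) :
    f - g = (f - ε • 1) * (1 + ε • g) := by
  ext z
  have hz : f (g z) = z := LinearMap.congr_fun hfg z
  simp only [LinearMap.sub_apply, Module.End.mul_apply, LinearMap.add_apply, LinearMap.smul_apply,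
    Module.End.one_apply, map_add, map_smul, hz]
  linear_combination (norm := module) hε • g z

theorem commute_sub_add (hfg : f * g = 1) (hgf : g * f = 1) :
    Commute (f - ε • 1) (1 + ε • g) := by
  have : Commute f g := hfg.trans hgf.symm
  refine Commute.sub_left (Commute.add_right (Commute.one_right _) (this.smul_right _))
    ((Commute.one_left _).smul_left _)

theorem injective_one_add (h2 : (2 : K) ≠ 0) (hfg : f * g = 1) (hε : ε * ε = 1)
    (hN : (f - ε • 1) ^ m = 0) : Function.Injective (1 + ε • g : M →ₗ[K] M) := by
  rw [← LinearMap.ker_eq_bot, LinearMap.ker_eq_bot']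
  intro z hz
  have hfz : (f - ε • 1) z = (-2 * ε) • z := by
    have h1 : f ((1 + ε • g) z) = f z + ε • z := by
      simp only [LinearMap.add_apply, LinearMap.smul_apply, map_add, map_smul, Module.End.one_apply]
      rw [← Module.End.mul_apply, hfg, Module.End.one_apply]
    rw [hz, map_zero] at h1
    have h3 : f z = -(ε • z) := eq_neg_of_add_eq_zero_left h1.symm
    simp only [LinearMap.sub_apply, LinearMap.smul_apply, Module.End.one_apply, h3]
    module
  have hpow : ∀ n : ℕ, ((f - ε • 1) ^ n) z = (-2 * ε) ^ n • z := fun n => by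
    induction n with
    | zero => simp
    | succ n ih => rw [pow_succ, Module.End.mul_apply, hfz, map_smul, ih, smul_smul, pow_succ']
  have := hpow m
  rw [hN, LinearMap.zero_apply, eq_comm, smul_eq_zero] at this
  refine this.resolve_left (pow_ne_zero _ (mul_ne_zero (neg_ne_zero.mpr h2) ?_))
  rintro rfl
  simp at hε

theorem sub_inverse_pow_eq_zero (hfg : f * g = 1) (hgf : g * f = 1) (hε : ε * ε = 1)
    (hN : (f - ε • 1) ^ m = 0) : (f - g) ^ m = 0 := by
  rw [sub_inverse_eq_mul hfg hε, (commute_sub_add hfg hgf).mul_pow, hN, zero_mul]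

theorem sub_smul_one_pow_eq_zero [FiniteDimensional K M] (h2 : (2 : K) ≠ 0) (hfg : f * g = 1)
    (hgf : g * f = 1) (hε : ε * ε = 1) (hN : (f - ε • 1) ^ m = 0) {n : ℕ}
    (hn : (f - g) ^ n = 0) : (f - ε • 1) ^ n = 0 := by
  rw [sub_inverse_eq_mul hfg hε, (commute_sub_add hfg hgf).mul_pow] at hn
  have hinj := injective_one_add h2 hfg hε hN
  have hsurj : Function.Surjective ((1 + ε • g : M →ₗ[K] M) ^ n) := by
    rw [Module.End.coe_pow]
    exact (LinearMap.surjective_of_injective hinj).iterate n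
  ext z
  obtain ⟨y, rfl⟩ := hsurj z
  rw [← Module.End.mul_apply, hn]
  rfl

/-- The cyclic subspace generated by a vector. -/
def cyclicSpan (f : M →ₗ[K] M) (x : M) : Submodule K M :=
  Submodule.span K (Set.range fun i : ℕ => (f ^ i) x)

theorem mem_cyclicSpan (f : M →ₗ[K] M) (x : M) : x ∈ cyclicSpan f x :=
  Submodule.subset_span ⟨0, by simp⟩

theorem map_cyclicSpan_le (f : M →ₗ[K] M) (x : M) : (cyclicSpan f x).map f ≤ cyclicSpan f x := by
  rw [cyclicSpan, Submodule.map_span_le]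
  rintro _ ⟨i, rfl⟩
  exact Submodule.subset_span ⟨i + 1, by simp [pow_succ']⟩

theorem map_eq_of_injective [FiniteDimensional K M] {U : Submodule K M}
    (hf : Function.Injective f) (hU : U.map f ≤ U) : U.map f = U :=
  Submodule.eq_of_le_of_finrank_le hU (Submodule.equivMapOfInjective f hf U).finrank_eq.le

theorem map_inverse_cyclicSpan_le [FiniteDimensional K M] (hgf : g * f = 1) (x : M) :
    (cyclicSpan f x).map g ≤ cyclicSpan f x := by
  have hf : Function.Injective f := Function.LeftInverse.injective (g := g) fun z => by
    rw [← Module.End.mul_apply, hgf, Module.End.one_apply]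
  conv_lhs => rw [← map_eq_of_injective hf (map_cyclicSpan_le f x)]
  rw [← Submodule.map_comp, ← Module.End.mul_eq_comp, hgf, Module.End.one_eq_id, Submodule.map_id]

theorem sub_inverse_mem_cyclicSpan [FiniteDimensional K M] (hgf : g * f = 1) {x z : M}
    (hz : z ∈ cyclicSpan f x) : (f - g) z ∈ cyclicSpan f x :=
  Submodule.sub_mem _ (map_cyclicSpan_le f x ⟨z, hz, rfl⟩)
    (map_inverse_cyclicSpan_le hgf x ⟨z, hz, rfl⟩)

theorem cyclicSpan_le_span_sup_map [FiniteDimensional K M] (h2 : (2 : K) ≠ 0) (hfg : f * g = 1)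
    (hgf : g * f = 1) (hε : ε * ε = 1) (hN : (f - ε • 1) ^ m = 0) (x : M) :
    cyclicSpan f x ≤ Submodule.span K {x} ⊔ (cyclicSpan f x).map (f - g) := by
  have hD : (cyclicSpan f x).map (1 + ε • g : M →ₗ[K] M) = cyclicSpan f x := by
    refine map_eq_of_injective (injective_one_add h2 hfg hε hN) ?_
    rintro _ ⟨z, hz, rfl⟩
    exact Submodule.add_mem _ hz
      (Submodule.smul_mem _ _ (map_inverse_cyclicSpan_le hgf x ⟨z, hz, rfl⟩))
  rw [sub_inverse_eq_mul hfg hε, Module.End.mul_eq_comp, Submodule.map_comp, hD]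
  conv_lhs => rw [cyclicSpan]
  rw [Submodule.span_le]
  rintro _ ⟨i, rfl⟩
  induction i with
  | zero => exact Submodule.mem_sup_left (Submodule.mem_span_singleton_self x)
  | succ i ih =>
    have : (f ^ (i + 1)) x = ε • (f ^ i) x + (f - ε • 1) ((f ^ i) x) := by
      simp [pow_succ']
    simp only [this]
    exact Submodule.add_mem _ (Submodule.smul_mem _ _ ih)
      (Submodule.mem_sup_right ⟨_, Submodule.subset_span ⟨i, rfl⟩, rfl⟩)

end Unipotent

section MinpolyOn

variable {φ : M ≃ₗ[K] M} {W : Submodule K M} {ε : K} {m : ℕ}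

theorem coe_aeval_restrict_pow (h : ∀ x ∈ W, (φ : M →ₗ[K] M) x ∈ W) (n : ℕ) (x : W) :
    ((aeval ((φ : M →ₗ[K] M).restrict h) ((X - C ε) ^ n) x : W) : M)
      = (((φ : M →ₗ[K] M) - ε • 1) ^ n) x := by
  induction n generalizing x with
  | zero => simp
  | succ n ih =>
    rw [pow_succ, map_mul, Module.End.mul_apply, ih, pow_succ, Module.End.mul_apply]
    simp [Module.algebraMap_end_apply]

theorem MinpolyOn.pow_apply_eq_zero (h : MinpolyOn φ W ((X - C ε) ^ m)) {x : M} (hx : x ∈ W) :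
    (((φ : M →ₗ[K] M) - ε • 1) ^ m) x = 0 := by
  obtain ⟨h, hmin⟩ := h
  have := coe_aeval_restrict_pow (ε := ε) h m ⟨x, hx⟩
  rw [← hmin, minpoly.aeval] at this
  exact this.symm

theorem MinpolyOn.le_of_pow_apply_eq_zero [FiniteDimensional K M]
    (h : MinpolyOn φ W ((X - C ε) ^ m)) {n : ℕ}
    (hn : ∀ x ∈ W, (((φ : M →ₗ[K] M) - ε • 1) ^ n) x = 0) : m ≤ n := by
  obtain ⟨h, hmin⟩ := h
  have h0 : aeval ((φ : M →ₗ[K] M).restrict h) ((X - C ε) ^ n) = 0 := by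
    ext x
    rw [coe_aeval_restrict_pow, hn x x.2]
    rfl
  have := natDegree_le_of_dvd (minpoly.dvd K _ h0) (pow_ne_zero _ (X_sub_C_ne_zero ε))
  rwa [hmin, natDegree_pow, natDegree_pow, natDegree_X_sub_C, mul_one, mul_one] at this

theorem MinpolyOn.le_finrank [FiniteDimensional K M] (h : MinpolyOn φ W ((X - C ε) ^ m)) :
    m ≤ Module.finrank K W := by
  obtain ⟨h, hmin⟩ := h
  have := natDegree_le_of_dvd (LinearMap.minpoly_dvd_charpoly ((φ : M →ₗ[K] M).restrict h))
    (LinearMap.charpoly_monic _).ne_zero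
  rwa [hmin, LinearMap.charpoly_natDegree, natDegree_pow, natDegree_X_sub_C, mul_one] at this

end MinpolyOn

theorem sub_symm_skew {φ : M ≃ₗ[K] M} (hφ : φ ∈ OG B) (x y : M) :
    B (((φ : M →ₗ[K] M) - (φ.symm : M →ₗ[K] M)) x) y
      = -B x (((φ : M →ₗ[K] M) - (φ.symm : M →ₗ[K] M)) y) := by
  have h1 : B (φ x) y = B x (φ.symm y) := by
    have := hφ x (φ.symm y)
    rwa [φ.apply_symm_apply] at this
  have h3 : B (φ.symm x) y = B x (φ y) := by
    have := hφ (φ.symm x) y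
    rwa [φ.apply_symm_apply, eq_comm] at this
  simp [h1, h3]

/-- The sizes of the Jordan blocks of an indecomposable isometry that is not cyclic are even. -/
theorem even_of_indecomposable [FiniteDimensional K M] (h2 : (2 : K) ≠ 0)
    (hsymm : ∀ x y, B x y = B y x) (hnd : ∀ x, (∀ y, B x y = 0) → x = 0)
    {φ : M ≃ₗ[K] M} (hφ : φ ∈ OG B) (hind : Indecomposable B φ) {ε : K} (hε : ε * ε = 1) {m : ℕ}
    (hN : ((φ : M →ₗ[K] M) - ε • 1) ^ m = 0)
    (hN' : ∀ n, ((φ : M →ₗ[K] M) - ε • 1) ^ n = 0 → m ≤ n) (hm : 0 < m → m < Module.finrank K M) :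
    Even m := by
  by_contra hodd
  obtain ⟨j, rfl⟩ := Nat.not_even_iff_odd.mp hodd
  set f : M →ₗ[K] M := (φ : M →ₗ[K] M) with hf
  set g : M →ₗ[K] M := (φ.symm : M →ₗ[K] M) with hg
  have hfg : f * g = 1 := by ext x; simp [hf, hg]
  have hgf : g * f = 1 := by ext x; simp [hf, hg]
  set A := f - g with hAdef
  have hA : ∀ x y, B (A x) y = -B x (A y) := sub_symm_skew hφ
  have hA0 : A ^ (2 * j + 1) = 0 := sub_inverse_pow_eq_zero hfg hgf hε hN
  have hA1 : A ^ (2 * j) ≠ 0 := fun h => by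
    have := hN' _ (sub_smul_one_pow_eq_zero h2 hfg hgf hε hN h)
    omega
  obtain ⟨x, hx⟩ : ∃ x, B x ((A ^ (2 * j)) x) ≠ 0 := by
    by_contra! hcon
    apply hA1
    ext y
    refine hnd _ fun x => ?_
    have hs : B y ((A ^ (2 * j)) x) = B x ((A ^ (2 * j)) y) := by
      rw [hsymm, skew_pow_apply hA, (even_two_mul j).neg_one_pow, one_mul]
    have h := hcon (x + y)
    simp only [map_add, LinearMap.add_apply, hcon, hs] at h
    rw [hsymm]
    apply mul_left_cancel₀ h2
    linear_combination h
  set U := cyclicSpan f x with hU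
  have hUA : U ≤ Submodule.span K {x} ⊔ U.map A := cyclicSpan_le_span_sup_map h2 hfg hgf hε hN x
  have hAU : ∀ (n : ℕ) (z : M), z ∈ U → (A ^ n) z ∈ U := by
    intro n
    induction n with
    | zero => exact fun _ hz => hz
    | succ n ih =>
      intro z hz
      rw [pow_succ, Module.End.mul_apply]
      exact ih _ (sub_inverse_mem_cyclicSpan hgf hz)
  have hxU : x ∈ U := mem_cyclicSpan f x
  have hsummand : IsOrthSummandIn B φ ⊤ U := by
    refine ⟨le_top, fun z hz => map_cyclicSpan_le f x ⟨z, hz, rfl⟩, fun y hy hy0 => ?_,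
      fun y hy => ⟨trivial, fun z hz => ?_⟩⟩
    · have key : ∀ n ≤ 2 * j + 1, y ∈ U.map (A ^ n) := fun n => by
        induction n with
        | zero => exact fun _ => ⟨y, hy, rfl⟩
        | succ n ih =>
          intro hn
          obtain ⟨u, hu, rfl⟩ := ih (by omega)
          obtain ⟨_, hc, _, ⟨v, hv, rfl⟩, rfl⟩ := Submodule.mem_sup.mp (hUA hu)
          obtain ⟨c, rfl⟩ := Submodule.mem_span_singleton.mp hc
          have h1 := hy0 _ (hAU (2 * j - n) x hxU)
          rw [skew_pow_apply hA, ← Module.End.mul_apply, ← pow_add,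
            Nat.add_sub_cancel' (by omega)] at h1
          have h3 := (mul_eq_zero.mp h1).resolve_left (pow_ne_zero _ (by simp))
          have h4 : B (A v) ((A ^ (2 * j)) x) = 0 := by
            rw [hA, ← Module.End.mul_apply, ← pow_succ', hA0]
            simp
          rw [map_add, LinearMap.add_apply, h4, add_zero, map_smul, LinearMap.smul_apply,
            smul_eq_mul] at h3
          have hc0 := (mul_eq_zero.mp h3).resolve_right hx
          exact ⟨v, hv, by simp [hc0, pow_succ]⟩
      have := key _ le_rfl
      rw [hA0, Submodule.map_zero] at this
      simpa using this
    · have h1 := hy.2 (g z) (map_inverse_cyclicSpan_le hgf x ⟨z, hz, rfl⟩)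
      rw [← hφ, show φ (g z) = z from φ.apply_symm_apply z] at h1
      exact h1
  rcases hind.2 U hsummand with h | h
  · rw [h] at hxU
    have : x = 0 := by simpa using hxU
    simp [this] at hx
  · have h1 := finrank_le_of_le_span_sup_map hUA hA0
    rw [h, finrank_top] at h1
    have := hm (by omega)
    omega

section AdaptedBasis

variable {n : ℕ} {σ : M ≃ₗ[K] M}
  {b : Module.Basis ((Fin n ⊕ Fin n) ⊕ (Fin n ⊕ Fin n)) K M}

theorem finrank_eq_of_hyperbolicSum_basis
    (b : Module.Basis ((Fin n ⊕ Fin n) ⊕ (Fin n ⊕ Fin n)) K M) :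
    Module.finrank K M = 4 * n := by
  rw [Module.finrank_eq_card_basis b]
  simp
  omega

theorem finrank_Fix_and_Bahn [FiniteDimensional K M] (h2 : (2 : K) ≠ 0)
    (hb : ∀ i, σ (b (.inl i)) = b (.inl i)) (hb' : ∀ i, σ (b (.inr i)) = -b (.inr i)) :
    (∀ i, b (.inl i) ∈ Fix σ) ∧ (∀ i, b (.inr i) ∈ Bahn σ) ∧
      Module.finrank K (Fix σ) = 2 * n ∧ Module.finrank K (Bahn σ) = 2 * n := by
  have hF : ∀ i, b (.inl i) ∈ Fix σ := fun i => by simp [Fix, hb]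
  have hR : ∀ i, b (.inr i) ∈ Bahn σ := fun i => by
    refine ⟨-(2⁻¹ : K) • b (.inr i), ?_⟩
    simp only [LinearMap.sub_apply, map_smul, LinearEquiv.coe_coe, hb', LinearMap.id_apply]
    linear_combination (norm := module) mul_inv_cancel₀ h2 • b (.inr i)
  have key : ∀ (u : Fin n ⊕ Fin n → M) (U : Submodule K M), LinearIndependent K u →
      (∀ i, u i ∈ U) → 2 * n ≤ Module.finrank K U := fun u U hu hU => by
    have h1 := finrank_span_eq_card hu
    have h3 := Submodule.finrank_mono (Submodule.span_le.mpr (Set.range_subset_iff.mpr hU))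
    simp at h1
    omega
  have h1 := key _ _ (b.linearIndependent.comp _ Sum.inl_injective) hF
  have h3 := key _ _ (b.linearIndependent.comp _ Sum.inr_injective) hR
  have h4 := LinearMap.finrank_range_add_finrank_ker ((σ : M →ₗ[K] M) - LinearMap.id)
  rw [finrank_eq_of_hyperbolicSum_basis b] at h4
  change Module.finrank K (Bahn σ) + Module.finrank K (Fix σ) = _ at h4
  exact ⟨hF, hR, by omega, by omega⟩

theorem isHyperbolic_of_family {U : Submodule K M} {t : Fin n → M} (ht : LinearIndependent K t)
    (htU : ∀ i, t i ∈ U) (htt : ∀ i j, B (t i) (t j) = 0) (hU : Module.finrank K U = 2 * n) :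
    IsHyperbolic B U := by
  refine ⟨Submodule.span K (Set.range t), Submodule.span_le.mpr (Set.range_subset_iff.mpr htU),
    fun x hx y hy => ?_, by rw [finrank_span_eq_card ht, hU, Fintype.card_fin]⟩
  have h1 : ∀ i, B (t i) y = 0 := fun i => by
    have : Submodule.span K (Set.range t) ≤ LinearMap.ker (B (t i)) :=
      Submodule.span_le.mpr (Set.range_subset_iff.mpr fun j => htt i j)
    exact this hy
  have : Submodule.span K (Set.range t) ≤ LinearMap.ker (B.flip y) :=
    Submodule.span_le.mpr (Set.range_subset_iff.mpr h1)
  exact this hx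

theorem isWallData_of_adapted_basis (h2 : (2 : K) ≠ 0)
    (hb : ∀ i, σ (b (.inl i)) = b (.inl i)) (hb' : ∀ i, σ (b (.inr i)) = -b (.inr i))
    (hG : ∀ i j, B (b i) (b j) = hyperbolicSumGram K n i j) :
    IsWallData B (fun i => b (.inr i))
      ((2⁻¹ : K) • Matrix.fromBlocks (0 : Matrix (Fin n) (Fin n) K) 1 1 0) (σ : M →ₗ[K] M) where
  det_ne_zero := by
    rw [Matrix.det_smul, det_hyperbolic]
    simp [h2]
  gram i j := by
    have hs : Matrix.fromBlocks (0 : Matrix (Fin n) (Fin n) K) 1 1 0 j i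
        = Matrix.fromBlocks (0 : Matrix (Fin n) (Fin n) K) 1 1 0 i j := by
      rcases i with i | i <;> rcases j with j | j <;> simp [Matrix.one_apply, eq_comm]
    have hrr : B (b (.inr i)) (b (.inr j)) =
        Matrix.fromBlocks (0 : Matrix (Fin n) (Fin n) K) 1 1 0 i j := hG _ _
    rw [hrr, Matrix.smul_apply, Matrix.smul_apply, hs, ← two_smul K, smul_smul,
      mul_inv_cancel₀ h2, one_smul]
  apply x := by
    have hrr : ∀ i j, B (b (.inr i)) (b (.inr j)) =
        Matrix.fromBlocks (0 : Matrix (Fin n) (Fin n) K) 1 1 0 i j := fun i j => hG _ _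
    have hrl : ∀ i j, B (b (.inr i)) (b (.inl j)) = 0 := fun i j => hG _ _
    refine ⟨fun i => 2 * b.repr x (.inr i), fun i => ?_, ?_⟩
    · conv_rhs => rw [← b.sum_repr x]
      rw [Fintype.sum_sum_type (α₁ := Fin n ⊕ Fin n)]
      simp only [map_add, map_sum, map_smul, hrl, hrr, mul_zero,
        Finset.sum_const_zero, zero_add, smul_eq_mul, Matrix.smul_apply]
      refine Finset.sum_congr rfl fun j _ => ?_
      field_simp
    · conv_lhs => rw [← b.sum_repr x]
      conv_rhs => enter [1]; rw [← b.sum_repr x]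
      rw [Fintype.sum_sum_type]
      simp only [map_add, map_sum, map_smul, LinearEquiv.coe_coe, hb, hb', smul_neg,
        mul_smul, two_smul, Finset.sum_neg_distrib, Finset.sum_add_distrib]
      abel

theorem det_of_adapted_basis
    (hb : ∀ i, σ (b (.inl i)) = b (.inl i)) (hb' : ∀ i, σ (b (.inr i)) = -b (.inr i)) :
    LinearMap.det (σ : M →ₗ[K] M) = 1 := by
  have h : LinearMap.toMatrix b b (σ : M →ₗ[K] M)
      = Matrix.diagonal (Sum.elim (fun _ => 1) (fun _ => -1)) := by
    ext i j
    rw [LinearMap.toMatrix_apply]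
    rcases j with j | j
    · rw [LinearEquiv.coe_coe, hb, b.repr_self, Finsupp.single_apply, Matrix.diagonal_apply]
      by_cases h : i = .inl j
      · simp [h]
      · simp [h, Ne.symm h]
    · rw [LinearEquiv.coe_coe, hb', map_neg, b.repr_self, Finsupp.neg_apply, Finsupp.single_apply,
        Matrix.diagonal_apply]
      by_cases h : i = .inr j
      · simp [h]
      · simp [h, Ne.symm h]
  rw [← LinearMap.det_toMatrix b, h, Matrix.det_diagonal]
  simp [← two_mul]

theorem exists_sprod_eq (h2 : (2 : K) ≠ 0) (hsymm : ∀ x y, B x y = B y x)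
    (hinv : ∀ x, σ (σ x) = x)
    (hb : ∀ i, σ (b (.inl i)) = b (.inl i)) (hb' : ∀ i, σ (b (.inr i)) = -b (.inr i))
    (hG : ∀ i j, B (b i) (b j) = hyperbolicSumGram K n i j) {l : List M}
    (hl : IsReflExpr B σ l) : ∃ a : K, a ≠ 0 ∧ sprod B l = (-1) ^ n * a ^ 2 := by
  obtain ⟨k, w, A, hw, -, hA⟩ := exists_isWallData_prod_reflMap h2 hsymm l hl.1
  rw [← hl.2] at hw
  have h := hw.mul hsymm (isWallData_of_adapted_basis h2 hb hb' hG)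
  have h1 : (σ : M →ₗ[K] M) * (σ : M →ₗ[K] M) = 1 := LinearMap.ext hinv
  rw [h1] at h
  obtain ⟨r, hr⟩ := h.isSquare_det h2
  have heven : Even k := by
    have := h.even_card h2
    simp only [Fintype.card_sum, Fintype.card_fin, Nat.even_iff] at this ⊢
    omega
  obtain ⟨q, rfl⟩ := heven
  have hr0 : r ≠ 0 := by
    rintro rfl
    exact h.det_ne_zero (by rw [hr, zero_mul])
  rw [Matrix.det_fromBlocks_zero₂₁, Matrix.det_smul, det_hyperbolic, Fintype.card_sum,
    Fintype.card_fin] at hr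
  have hsq : ((-1 : K) ^ n) * (-1) ^ n = 1 := by rw [← mul_pow]; simp
  refine ⟨r * 2 ^ n * 2 ^ q, by simp [hr0, h2], ?_⟩
  have h3 : (2⁻¹ : K) ^ (n + n) * 2 ^ (n + n) = 1 := by
    rw [← mul_pow, inv_mul_cancel₀ h2, one_pow]
  rw [← hA]
  calc A.det * 2 ^ (q + q)
      = A.det * 2 ^ (q + q) * (((-1) ^ n * (-1) ^ n) * ((2⁻¹) ^ (n + n) * 2 ^ (n + n))) := by
        rw [hsq, h3]; ring
    _ = (-1) ^ n * (A.det * ((2⁻¹) ^ (n + n) * (-1) ^ n)) * (2 ^ (n + n) * 2 ^ (q + q)) := by ring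
    _ = (-1) ^ n * (r * 2 ^ n * 2 ^ q) ^ 2 := by rw [hr]; ring

/-- Two involutions with adapted bases of the same size are conjugate by an isometry. -/
theorem exists_conj_of_adapted_basis {σ' : M ≃ₗ[K] M}
    {b' : Module.Basis ((Fin n ⊕ Fin n) ⊕ (Fin n ⊕ Fin n)) K M}
    (hb : ∀ i, σ (b (.inl i)) = b (.inl i)) (hb' : ∀ i, σ (b (.inr i)) = -b (.inr i))
    (hG : ∀ i j, B (b i) (b j) = hyperbolicSumGram K n i j)
    (hc : ∀ i, σ' (b' (.inl i)) = b' (.inl i)) (hc' : ∀ i, σ' (b' (.inr i)) = -b' (.inr i))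
    (hG' : ∀ i j, B (b' i) (b' j) = hyperbolicSumGram K n i j) :
    ∃ η ∈ OG B, η * σ * η⁻¹ = σ' := by
  let η : M ≃ₗ[K] M := b.equiv b' (Equiv.refl _)
  have hη : ∀ i, η (b i) = b' i := fun i => by simp [η]
  refine ⟨η, ?_, ?_⟩
  · have : B.compl₁₂ (η : M →ₗ[K] M) (η : M →ₗ[K] M) = B :=
      b.ext fun i => b.ext fun j => by simp [hη, hG, hG']
    exact fun x y => LinearMap.congr_fun₂ this x y
  · rw [mul_inv_eq_iff_eq_mul]
    apply LinearEquiv.toLinearMap_injective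
    refine b.ext ?_
    rintro (i | i)
    · simp [hb, hη, hc]
    · simp [hb', hη, hc']

end AdaptedBasis

/-- Involutions reversing an orthogonally indecomposable isometry of type 1. -/
theorem type_one_reversing_involution {K : Type*} [Field K] {M : Type*}
    [AddCommGroup M] [Module K M] [FiniteDimensional K M]
    (h2 : (2 : K) ≠ 0) (B : LinearMap.BilinForm K M)
    (hsymm : ∀ x y, B x y = B y x) (hnd : ∀ x, (∀ y, B x y = 0) → x = 0)
    (φ : M ≃ₗ[K] M) (hφ : φ ∈ OG B) (hind : Indecomposable B φ) (htype : IsType1 φ)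
    (σ : M ≃ₗ[K] M) (hσ : σ ∈ OG B) (hinv : σ ^ 2 = 1) (hrev : σ * φ * σ⁻¹ = φ⁻¹) :
    IsHyperbolic B (Bahn σ) ∧ IsHyperbolic B (Fix σ) ∧
    2 * Module.finrank K (Bahn σ) = Module.finrank K M ∧
    2 * Module.finrank K (Fix σ) = Module.finrank K M ∧
    φ ∈ ΩG B ∧
    LinearMap.det ((σ : M →ₗ[K] M)) = 1 ∧
    ∀ l, IsReflExpr B σ l →
      ∃ a : K, a ≠ 0 ∧ sprod B l = (-1) ^ (Module.finrank K M / 4) * a ^ 2 := by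
  have hσσ : ∀ x, σ (σ x) = x := fun x => by
    rw [← LinearEquiv.mul_apply, ← sq, hinv]
    rfl
  have hσφ : ∀ x, σ (φ x) = φ.symm (σ x) := fun x => by
    rw [mul_inv_eq_iff_eq_mul] at hrev
    exact DFunLike.congr_fun hrev x
  obtain ⟨W₁, W₂, ε, m, hW₁, -, hinf, hsup, -, -, ⟨u₁, hu₁⟩, ⟨u₂, hu₂⟩, hε, hm₁, hm₂⟩ := htype
  replace hε : ε * ε = 1 := by rcases hε with rfl | rfl <;> norm_num
  have hN : ((φ : M →ₗ[K] M) - ε • 1) ^ m = 0 := by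
    ext x
    obtain ⟨y, hy, z, hz, rfl⟩ := Submodule.mem_sup.mp (hsup.symm ▸ Submodule.mem_top : x ∈ W₁ ⊔ W₂)
    rw [map_add, hm₁.pow_apply_eq_zero hy, hm₂.pow_apply_eq_zero hz]
    simp
  have hN' : ∀ n, ((φ : M →ₗ[K] M) - ε • 1) ^ n = 0 → m ≤ n := fun n hn =>
    hm₁.le_of_pow_apply_eq_zero fun x _ => by rw [hn]; rfl
  have hfg : (φ : M →ₗ[K] M) * (φ.symm : M →ₗ[K] M) = 1 := by ext x; simp
  have hgf : (φ.symm : M →ₗ[K] M) * (φ : M →ₗ[K] M) = 1 := by ext x; simp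
  have hdim := Submodule.finrank_sup_add_finrank_inf_eq W₁ W₂
  rw [hsup, hinf, finrank_top, finrank_bot, add_zero] at hdim
  have hA0 := sub_inverse_pow_eq_zero hfg hgf hε hN
  have hle : ∀ u, Module.finrank K (cyclicSpan (φ : M →ₗ[K] M) u) ≤ m := fun u =>
    finrank_le_of_le_span_sup_map (cyclicSpan_le_span_sup_map h2 hfg hgf hε hN u) hA0
  have hle₁ : Module.finrank K W₁ ≤ m := by rw [hu₁]; exact hle u₁
  have hle₂ : Module.finrank K W₂ ≤ m := by rw [hu₂]; exact hle u₂
  have hge₁ := hm₁.le_finrank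
  have hge₂ := hm₂.le_finrank
  have hmpos : 0 < m := by
    rcases Nat.eq_zero_or_pos m with rfl | h
    · exact absurd (Submodule.finrank_eq_zero.mp (Nat.le_zero.mp hle₁)) hW₁
    · exact h
  have heven := even_of_indecomposable h2 hsymm hnd hφ hind hε hN hN' (fun _ => by omega)
  obtain ⟨k, rfl⟩ : ∃ k, m = 2 * k + 2 := by
    rw [Nat.even_iff] at heven
    exact ⟨m / 2 - 1, by omega⟩
  have hA1 : ((φ : M →ₗ[K] M) - (φ.symm : M →ₗ[K] M)) ^ (2 * k + 1) ≠ 0 := fun h => by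
    have := hN' _ (sub_smul_one_pow_eq_zero h2 hfg hgf hε hN h)
    omega
  have hσφs : ∀ x, σ (φ.symm x) = φ (σ x) := fun x => by
    have := hσφ (φ.symm x)
    rw [φ.apply_symm_apply] at this
    rw [this, φ.apply_symm_apply]
  obtain ⟨b, hb, hb', hG⟩ := exists_adapted_basis (S := (σ : M →ₗ[K] M)) h2 hsymm hnd (by omega)
    (sub_symm_skew hφ) hσσ hσ (fun x => by simp [hσφ, hσφs]) hA0 hA1
  have hρ : σ * φ ∈ OG B := (OG B).mul_mem hσ hφ
  obtain ⟨c, hc, hc', hGc⟩ := exists_adapted_basis (S := ((σ * φ : M ≃ₗ[K] M) : M →ₗ[K] M))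
    h2 hsymm hnd (by omega) (sub_symm_skew hφ)
    (fun x => by simp [hσφ, hσσ]) hρ
    (fun x => by simp [hσφ]) hA0 hA1
  obtain ⟨hF, hR, hdF, hdR⟩ := finrank_Fix_and_Bahn h2 hb hb'
  have hdM := finrank_eq_of_hyperbolicSum_basis b
  refine ⟨?_, ?_, by omega, by omega, ?_, det_of_adapted_basis hb hb', fun l hl => ?_⟩
  · exact isHyperbolic_of_family (t := fun i => b (.inr (.inl i)))
      (b.linearIndependent.comp _ (Sum.inr_injective.comp Sum.inl_injective)) (fun i => hR _)
      (fun i j => by simp [hG]) hdR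
  · exact isHyperbolic_of_family (t := fun i => b (.inl (.inl i)))
      (b.linearIndependent.comp _ (Sum.inl_injective.comp Sum.inl_injective)) (fun i => hF _)
      (fun i j => by simp [hG]) hdF
  · obtain ⟨η, hη, hconj⟩ := exists_conj_of_adapted_basis hb hb' hG hc hc' hGc
    have hσi : σ⁻¹ = σ := inv_eq_of_mul_eq_one_left (by rw [← sq, hinv])
    have : φ = σ * η * σ⁻¹ * η⁻¹ := by
      rw [hσi, mul_assoc, mul_assoc, ← mul_assoc η, hconj, ← mul_assoc, ← sq,
        hinv, one_mul]
    rw [this]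
    exact Subgroup.commutator_mem_commutator hσ hη
  · rw [hdM, Nat.mul_div_cancel_left _ (by norm_num)]
    exact exists_sprod_eq h2 hsymm hσσ hb hb' hG hl

end GenBireflect
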